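/- arXiv:math/9604211 — 2 statements merged into one kernel-verified Lean document; each statement's English description precedes it below -/
import Mathlib

section
/- Suppose that every subset S ⊆ 2^ℕ of cardinality strictly less than 2^{ℵ₀} is ν-null. Then there exists a (2^{ℵ₀}, 2^{ℵ₀})-witness: a family (C_{α,n})_{α<2^{ℵ₀}, n∈ℕ} of closed subsets of Cantor space 2^ℕ such that ν(C_{α,n}) > n/(n+1) for all α and n, and for every f ∈ 2^ℕ the set {α < 2^{ℵ₀} : ∃n ∈ ℕ, f ∈ C_{α,n}} has cardinality strictly less than 2^{ℵ₀}. (The combinatorial core of the paper's Corollary 4; the hypothesis holds, e.g., under Martin's Axiom.) -/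
open MeasureTheory Set
open scoped ENNReal

/-- A family of sets has the finite intersection property if every finite
subfamily has nonempty intersection. -/
def HasFIP {Ω : Type*} (D : Set (Set Ω)) : Prop :=
  ∀ F : Finset (Set Ω), ↑F ⊆ D → (⋂₀ (F : Set (Set Ω))).Nonempty

/-- A family `C` of sets is compact if every subfamily with the finite
intersection property has nonempty intersection. -/
def IsCompactFamily {Ω : Type*} (C : Set (Set Ω)) : Prop :=
  ∀ D ⊆ C, HasFIP D → (⋂₀ D).Nonempty

/-- `P` is inner regular with respect to the family `C`:
for every measurable `A`, `P A = sup {P B : B ∈ C, B ⊆ A}`. -/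
def IsInnerRegularFamily {Ω : Type*} [MeasurableSpace Ω] (P : Measure Ω)
    (C : Set (Set Ω)) : Prop :=
  ∀ A : Set Ω, MeasurableSet A → P A = ⨆ (B : Set Ω) (_ : B ∈ C ∧ B ⊆ A), P B

/-- A probability space is compact in the sense of Ross if it carries an
inner-regular compact family of measurable sets. -/
def RossCompact {Ω : Type*} [MeasurableSpace Ω] (P : Measure Ω) : Prop :=
  ∃ C : Set (Set Ω), (∀ B ∈ C, MeasurableSet B) ∧
    IsInnerRegularFamily P C ∧ IsCompactFamily C

/-- A family `(A i)` of sets is independent for `P` if the measure of every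
finite intersection is the product of the measures. -/
def IndepFamily {Ω : Type*} {I : Type*} [MeasurableSpace Ω] (P : Measure Ω)
    (A : I → Set Ω) : Prop :=
  ∀ s : Finset I, P (⋂ i ∈ s, A i) = ∏ i ∈ s, P (A i)

/-- `ν` is the coin-flipping product probability measure on Cantor space
`ℕ → Bool`: every cylinder determined by finitely many coordinates `s` has
measure `(1/2) ^ |s|`. -/
def IsCoinFlipMeasure (ν : Measure (ℕ → Bool)) : Prop :=
  IsProbabilityMeasure ν ∧
    ∀ (s : Finset ℕ) (g : ℕ → Bool),
      ν {f : ℕ → Bool | ∀ n ∈ s, f n = g n} = (1 / 2 : ℝ≥0∞) ^ s.card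

/-- Every infinite type has a well-order all of whose initial segments, with or without their
endpoint, have smaller cardinality than the type. -/
theorem exists_wellOrder_mk_le_lt {X : Type*} (hX : Cardinal.aleph0 ≤ Cardinal.mk X) :
    ∃ r : X → X → Prop, IsWellOrder X r ∧ (∀ x, Cardinal.mk {y | r y x} < Cardinal.mk X) ∧
      ∀ x, Cardinal.mk {y | ¬ r x y} < Cardinal.mk X := by
  obtain ⟨r, hr, hord⟩ := Cardinal.exists_ord_eq X
  have hlt : ∀ x, Cardinal.mk {y | r y x} < Cardinal.mk X := fun x =>
    Cardinal.card_typein_lt x hord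
  refine ⟨r, hr, hlt, fun x => ?_⟩
  have hsub : {y | ¬ r x y} ⊆ {y | r y x} ∪ {x} := fun y hy => by
    rcases trichotomous_of r x y with h | h | h
    · exact absurd h hy
    · exact Or.inr h.symm
    · exact Or.inl h
  calc Cardinal.mk {y | ¬ r x y} ≤ Cardinal.mk ({y | r y x} ∪ {x} : Set X) :=
        Cardinal.mk_le_mk_of_subset hsub
    _ ≤ Cardinal.mk {y | r y x} + Cardinal.mk ({x} : Set X) := Cardinal.mk_union_le _ _
    _ < Cardinal.mk X := Cardinal.add_lt_of_lt hX (hlt x)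
        ((Cardinal.mk_singleton x).trans_lt (Cardinal.one_lt_aleph0.trans_le hX))

/-- The complement of a null set contains closed sets of measure arbitrarily close to one. -/
theorem exists_isClosed_disjoint_lt_measure {X : Type*} [TopologicalSpace X] [MeasurableSpace X]
    [BorelSpace X] [TopologicalSpace.PseudoMetrizableSpace X] (ν : Measure X)
    [IsProbabilityMeasure ν] {S : Set X} (hS : ν S = 0) {r : ℝ≥0∞} (hr : r < 1) :
    ∃ C, IsClosed C ∧ Disjoint C S ∧ r < ν C := by
  have hm : MeasurableSet (toMeasurable ν S)ᶜ := (measurableSet_toMeasurable ν S).compl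
  have h1 : r < ν (toMeasurable ν S)ᶜ := by
    rwa [prob_compl_eq_one_sub (measurableSet_toMeasurable ν S), measure_toMeasurable, hS,
      tsub_zero]
  obtain ⟨C, hCS, hC, hlt⟩ := hm.exists_lt_isClosed_of_ne_top (measure_ne_top _ _) h1
  exact ⟨C, hC, (subset_compl_iff_disjoint_right.1 hCS).mono_right (subset_toMeasurable ν S), hlt⟩

/-- **Corollary 4 of Jin–Shelah (combinatorial core).** If every subset of
Cantor space of cardinality `< 2^ℵ₀` is `ν`-null, then there is a
`(2^ℵ₀, 2^ℵ₀)`-witness: a family `(C α n)` of closed subsets of Cantor space,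
indexed by `α < 2^ℵ₀` and `n ∈ ℕ`, with `ν (C α n) > n/(n+1)` and such that
each `f ∈ 2^ℕ` belongs to some `C α n` for fewer than `2^ℵ₀` many `α`. -/
theorem exists_continuum_witness_of_small_sets_null
    (ν : Measure (ℕ → Bool)) (hν : IsCoinFlipMeasure ν)
    (hnull : ∀ S : Set (ℕ → Bool), Cardinal.mk S < Cardinal.continuum → ν S = 0) :
    ∃ C : Cardinal.continuum.out → ℕ → Set (ℕ → Bool),
      (∀ (α : Cardinal.continuum.out) (n : ℕ), IsClosed (C α n)) ∧
      (∀ (α : Cardinal.continuum.out) (n : ℕ),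
        (n : ℝ≥0∞) / ((n : ℝ≥0∞) + 1) < ν (C α n)) ∧
      (∀ f : ℕ → Bool,
        Cardinal.mk {α : Cardinal.continuum.out | ∃ n, f ∈ C α n} < Cardinal.continuum) := by
  have := hν.1
  have hX : Cardinal.mk (ℕ → Bool) = Cardinal.continuum := by simp
  obtain ⟨r, -, hlt, hle⟩ := exists_wellOrder_mk_le_lt (hX ▸ Cardinal.aleph0_le_continuum)
  rw [hX] at hlt hle
  obtain ⟨e⟩ : Nonempty (Cardinal.continuum.out ≃ (ℕ → Bool)) :=
    Cardinal.lift_mk_eq'.1 (by simp)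
  have hfrac : ∀ n : ℕ, (n : ℝ≥0∞) / ((n : ℝ≥0∞) + 1) < 1 := fun n =>
    ENNReal.div_lt_of_lt_mul (by exact_mod_cast (by omega : n < 1 * (n + 1)))
  choose C hclosed hdisj hmeas using fun α (n : ℕ) =>
    exists_isClosed_disjoint_lt_measure ν (hnull _ (hle (e α))) (hfrac n)
  refine ⟨C, hclosed, hmeas, fun f => ?_⟩
  have hsub : {α | ∃ n, f ∈ C α n} ⊆ e ⁻¹' {g | r g f} := by
    rintro α ⟨n, hn⟩
    exact not_not.1 fun h => disjoint_left.1 (hdisj α n) hn h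
  refine (Cardinal.mk_le_mk_of_subset hsub).trans_lt (Cardinal.lift_lt.1 ?_)
  rw [Cardinal.mk_preimage_equiv_lift]
  simpa using hlt f
end

section
/- Let κ be a regular uncountable cardinal and suppose 2^ℕ = ⋃_{β<κ} Z_β where (Z_β)_{β<κ} is an increasing sequence of ν-null subsets of Cantor space. Let (Ω, Σ, P) be a probability space and let (Σ_β)_{β<κ} be an increasing sequence of families of measurable sets whose union Σ₀ := ⋃_{β<κ} Σ_β is an algebra of subsets of Ω such that: (i) P is inner regular with respect to Σ₀; (ii) for every β < κ and every sequence (A_n)_{n∈ℕ} of members of Σ_β there exists B ∈ Σ_{β+1} with B ⊆ ⋂_{n∈ℕ} A_n and P(B) = P(⋂_{n∈ℕ} A_n); (iii) for every β < κ, every subfamily of Σ_β with the finite intersection property has nonempty intersection; (iv) there exists an independent sequence (A_n)_{n∈ℕ} of members of Σ_0 with P(A_n) = 1/2 for all n. Then (Ω, Σ, P) is compact in the sense of Ross. (Paper's Theorem 6, with the consequences of the ℵ₀-special model axiom that the proof uses stated as explicit hypotheses on the specializing sequence (Σ_β).) -/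
open MeasureTheory Set
open scoped ENNReal

/-- The point of Cantor space recording which of the sets `A n` contain `ω`. -/
noncomputable def membershipCode {Ω : Type*} (A : ℕ → Set Ω) (ω : Ω) : ℕ → Bool :=
  open scoped Classical in fun n => decide (ω ∈ A n)

lemma membershipCode_eq_true {Ω : Type*} {A : ℕ → Set Ω} {ω : Ω} {n : ℕ} :
    membershipCode A ω n = true ↔ ω ∈ A n := by
  simp [membershipCode]

lemma membershipCode_eq_false {Ω : Type*} {A : ℕ → Set Ω} {ω : Ω} {n : ℕ} :
    membershipCode A ω n = false ↔ ω ∉ A n := by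
  simp [membershipCode]

lemma measurable_membershipCode {Ω : Type*} [MeasurableSpace Ω] {A : ℕ → Set Ω}
    (hA : ∀ n, MeasurableSet (A n)) : Measurable (membershipCode A) := by
  refine measurable_pi_lambda _ fun n => measurable_to_bool ?_
  convert hA n using 1
  ext ω
  simp [membershipCode_eq_true]

/-- The basic clopen set of points of Cantor space that take the value `true` on `p.1` and
`false` on `p.2`. -/
def boolCylinder (p : Finset ℕ × Finset ℕ) : Set (ℕ → Bool) :=
  {f | (∀ n ∈ p.1, f n = true) ∧ ∀ n ∈ p.2, f n = false}

lemma exists_mem_boolCylinder_subset {U : Set (ℕ → Bool)} (hU : IsOpen U) {f : ℕ → Bool}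
    (hf : f ∈ U) : ∃ p, f ∈ boolCylinder p ∧ boolCylinder p ⊆ U := by
  obtain ⟨I, u, hu, hIU⟩ := isOpen_pi_iff.1 hU f hf
  refine ⟨(I.filter (f · = true), I.filter (f · = false)), ?_, fun g hg => hIU fun n hn => ?_⟩
  · simp [boolCylinder]
  · have hgf : g n = f n := by
      cases h : f n
      · exact hg.2 n (by simpa [h] using hn)
      · exact hg.1 n (by simpa [h] using hn)
    rw [hgf]
    exact (hu n hn).2

/-- A family of sets that contains `univ` and is closed under binary intersections and
complements contains the preimage under `membershipCode A` of every basic clopen set. -/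
lemma preimage_boolCylinder_mem {Ω : Type*} {S0 : Set (Set Ω)} (huniv : univ ∈ S0)
    (hinter : ∀ A ∈ S0, ∀ B ∈ S0, A ∩ B ∈ S0) (hcompl : ∀ A ∈ S0, Aᶜ ∈ S0)
    {A : ℕ → Set Ω} (hA : ∀ n, A n ∈ S0) (p : Finset ℕ × Finset ℕ) :
    membershipCode A ⁻¹' boolCylinder p ∈ S0 := by
  have hfin : ∀ (E : ℕ → Set Ω), (∀ n, E n ∈ S0) → ∀ s : Finset ℕ, (⋂ n ∈ s, E n) ∈ S0 := by
    intro E hE s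
    induction s using Finset.induction_on with
    | empty => simpa using huniv
    | insert a s _ ih =>
      rw [Finset.set_biInter_insert]
      exact hinter _ (hE a) _ ih
  have heq : membershipCode A ⁻¹' boolCylinder p
      = (⋂ n ∈ p.1, A n) ∩ ⋂ n ∈ p.2, (A n)ᶜ := by
    ext ω
    simp [boolCylinder, membershipCode_eq_true, membershipCode_eq_false]
  rw [heq]
  exact hinter _ (hfin A hA p.1) _ (hfin _ (fun n => hcompl _ (hA n)) p.2)

/-- The membership code of an independent sequence of sets of measure `1/2` is distributed
according to the coin-flipping measure. -/
lemma map_membershipCode {Ω : Type*} [MeasurableSpace Ω] {P : Measure Ω}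
    [IsProbabilityMeasure P] {ν : Measure (ℕ → Bool)} (hν : IsCoinFlipMeasure ν)
    {A : ℕ → Set Ω} (hA : ∀ n, MeasurableSet (A n)) (hindep : IndepFamily P A)
    (hhalf : ∀ n, P (A n) = 1 / 2) : P.map (membershipCode A) = ν := by
  have hmeas := measurable_membershipCode hA
  have := hν.1
  have := Measure.isProbabilityMeasure_map (μ := P) hmeas.aemeasurable
  have hcyl : ∀ s : Finset ℕ, MeasurableSet {f : ℕ → Bool | ∀ n ∈ s, f n = true} := by
    intro s
    have : {f : ℕ → Bool | ∀ n ∈ s, f n = true} = ⋂ n ∈ s, (fun f => f n) ⁻¹' {true} := by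
      ext; simp
    rw [this]
    exact s.measurableSet_biInter fun n _ => measurable_pi_apply n (measurableSet_singleton _)
  refine ext_of_generate_finite
    (range fun s : Finset ℕ => {f : ℕ → Bool | ∀ n ∈ s, f n = true}) ?_ ?_ ?_ (by simp)
  · refine le_antisymm ?_ (MeasurableSpace.generateFrom_le ?_)
    · refine iSup_le fun n => ?_
      rw [← measurable_iff_comap_le]
      refine @measurable_to_bool _ (MeasurableSpace.generateFrom _) _
        (MeasurableSpace.measurableSet_generateFrom ⟨{n}, ?_⟩)
      ext; simp
    · rintro _ ⟨s, rfl⟩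
      exact hcyl s
  · rintro _ ⟨s, rfl⟩ _ ⟨t, rfl⟩ -
    refine ⟨s ∪ t, ?_⟩
    ext f
    simp only [Finset.mem_union, mem_ofPred_eq, mem_inter_iff, or_imp, forall_and]
  · rintro _ ⟨s, rfl⟩
    rw [Measure.map_apply hmeas (hcyl s), hν.2 s fun _ => true]
    have : membershipCode A ⁻¹' {f | ∀ n ∈ s, f n = true} = ⋂ n ∈ s, A n := by
      ext; simp [membershipCode_eq_true]
    rw [this, hindep s, Finset.prod_congr rfl fun n _ => hhalf n, Finset.prod_const]

/-- A countable subset of a union of an increasing chain indexed by a regular uncountable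
cardinal is contained in a member of the chain. -/
lemma exists_stage_of_countable {κ : Cardinal.{u}} (hreg : κ.IsRegular)
    (hκ : Cardinal.aleph0 < κ) {α : Type*} {S : Ordinal.{u} → Set α}
    (hSmono : ∀ β γ : Ordinal.{u}, β ≤ γ → γ < κ.ord → S β ⊆ S γ)
    {ι : Type} [Countable ι] {a : ι → α} (ha : ∀ i, ∃ β < κ.ord, a i ∈ S β) :
    ∃ γ < κ.ord, ∀ i, a i ∈ S γ := by
  choose b hb hab using ha
  have hlt : ⨆ i, b i < κ.ord := by
    refine Ordinal.lift_iSup_lt_of_lt_cof ?_ hb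
    rw [Ordinal.lift_uzero, hreg.cof_ord]
    refine lt_of_le_of_lt ?_ hκ
    simp
  exact ⟨_, hlt, fun i => hSmono _ _ (le_ciSup (Ordinal.bddAbove_of_small) i) hlt (hab i)⟩

/-- A family of members of a fixed ultrafilter has the finite intersection property. -/
lemma hasFIP_of_subset_ultrafilter {Ω : Type*} (𝒰 : Ultrafilter Ω) {D : Set (Set Ω)}
    (hD : ∀ B ∈ D, B ∈ 𝒰) : HasFIP D := fun F hF =>
  𝒰.nonempty_of_mem <| (Filter.sInter_mem F.finite_toSet).2 fun B hB => hD B (hF hB)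

/-- **Theorem 6 of Jin–Shelah.** Let `κ` be a regular uncountable cardinal and
suppose Cantor space is the union of an increasing `κ`-sequence of `ν`-null
sets. If a probability space `(Ω, Σ, P)` carries an increasing `κ`-sequence
`(S β)` of families of measurable sets whose union `S0` is an algebra such
that `P` is inner regular with respect to `S0`, countable intersections of
members of `S β` are approximated from inside by members of `S (β+1)`, every
subfamily of each `S β` with the finite intersection property has nonempty
intersection, and `S 0` contains an independent sequence of sets of measure
`1/2`, then `(Ω, Σ, P)` is compact in the sense of Ross. -/
theorem loeb_compact_of_specializing_sequence
    (ν : Measure (ℕ → Bool)) (hν : IsCoinFlipMeasure ν)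
    (κ : Cardinal.{u}) (hreg : κ.IsRegular) (hκ : Cardinal.aleph0 < κ)
    -- Cantor space is an increasing union of κ many null sets
    (Z : Ordinal.{u} → Set (ℕ → Bool))
    (hZmono : ∀ β γ : Ordinal.{u}, β ≤ γ → γ < κ.ord → Z β ⊆ Z γ)
    (hZnull : ∀ β : Ordinal.{u}, β < κ.ord → ν (Z β) = 0)
    (hZcover : ∀ f : ℕ → Bool, ∃ β : Ordinal.{u}, β < κ.ord ∧ f ∈ Z β)
    -- the probability space and the specializing sequence (S β)
    {Ω : Type u} [MeasurableSpace Ω] (P : Measure Ω) [IsProbabilityMeasure P]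
    (S : Ordinal.{u} → Set (Set Ω))
    (hSmono : ∀ β γ : Ordinal.{u}, β ≤ γ → γ < κ.ord → S β ⊆ S γ)
    (S0 : Set (Set Ω)) (hS0 : S0 = {A : Set Ω | ∃ β : Ordinal.{u}, β < κ.ord ∧ A ∈ S β})
    (hmeas : ∀ A ∈ S0, MeasurableSet A)
    (huniv : Set.univ ∈ S0)
    (hunion : ∀ A ∈ S0, ∀ B ∈ S0, A ∪ B ∈ S0)
    (hinter : ∀ A ∈ S0, ∀ B ∈ S0, A ∩ B ∈ S0)
    (hcompl : ∀ A ∈ S0, Aᶜ ∈ S0)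
    -- (i) inner regularity with respect to S0
    (hinner : ∀ A : Set Ω, MeasurableSet A →
      P A = ⨆ (B : Set Ω) (_ : B ∈ S0 ∧ B ⊆ A), P B)
    -- (ii) countable intersections drop into the next stage
    (hcap : ∀ β : Ordinal.{u}, β < κ.ord → ∀ A : ℕ → Set Ω, (∀ n, A n ∈ S β) →
      ∃ B ∈ S (β + 1), B ⊆ (⋂ n, A n) ∧ P B = P (⋂ n, A n))
    -- (iii) saturation at each stage
    (hsat : ∀ β : Ordinal.{u}, β < κ.ord → ∀ D ⊆ S β, HasFIP D → (⋂₀ D).Nonempty)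
    -- (iv) an independent sequence of measure 1/2 in S 0
    (A : ℕ → Set Ω) (hA0 : ∀ n, A n ∈ S 0) (hAindep : IndepFamily P A)
    (hAhalf : ∀ n, P (A n) = 1 / 2) :
    RossCompact P := by
  have hAS0 : ∀ n, A n ∈ S0 := fun n => hS0 ▸ ⟨0, hreg.ord_pos, hA0 n⟩
  have hmap : P.map (membershipCode A) = ν :=
    map_membershipCode hν (fun n => hmeas _ (hAS0 n)) hAindep hAhalf
  have hcode := measurable_membershipCode fun n => hmeas _ (hAS0 n)
  have hcyl := fun p => hcompl _ (preimage_boolCylinder_mem huniv hinter hcompl hAS0 p)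
  obtain ⟨γ₁, hγ₁, hcyl⟩ := exists_stage_of_countable hreg hκ hSmono fun p => hS0 ▸ hcyl p
  obtain ⟨γ₂, hγ₂, hAcompl⟩ :=
    exists_stage_of_countable hreg hκ hSmono fun n => hS0 ▸ hcompl _ (hAS0 n)
  have := hν.1
  refine ⟨{C | ∃ β, γ₂ ≤ β ∧ β < κ.ord ∧ C ∈ S β ∧ ∀ ω ∈ C, membershipCode A ω ∉ Z β},
    ?_, fun E hE => le_antisymm ?_ ?_, fun D hD hfip => ?_⟩
  · rintro B ⟨β, -, hβ, hB, -⟩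
    exact hmeas B (hS0 ▸ ⟨β, hβ, hB⟩)
  · refine le_of_forall_lt fun r hr => ?_
    rw [hinner E hE] at hr
    simp only [lt_iSup_iff] at hr ⊢
    obtain ⟨B, ⟨hBS0, hBE⟩, hrB⟩ := hr
    obtain ⟨β, hβ, hBβ⟩ := hS0 ▸ hBS0
    let δ := max β (max γ₁ γ₂)
    have hδ : δ < κ.ord := max_lt hβ (max_lt hγ₁ hγ₂)
    have hδ' : δ + 1 < κ.ord :=
      (Cardinal.isSuccLimit_ord hreg.aleph0_le).add_one_lt hδ
    -- Remove from `B` an open set of codes that covers `Z (δ + 1)`.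
    obtain ⟨U, hZU, hU, hνU⟩ := (Z (δ + 1)).exists_isOpen_lt_of_lt (μ := ν) (P B - r)
      (by rw [hZnull _ hδ']; exact tsub_pos_of_lt hrB)
    obtain ⟨e, he⟩ := exists_surjective_nat (Finset ℕ × Finset ℕ)
    classical
    let G : ℕ → Set Ω := fun n => Nat.casesOn n B fun k =>
      if boolCylinder (e k) ⊆ U then (membershipCode A ⁻¹' boolCylinder (e k))ᶜ else B
    have hG : ∀ n, G n ∈ S δ := by
      have hBδ : B ∈ S δ := hSmono _ _ (le_max_left _ _) hδ hBβ
      rintro (_ | k)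
      · exact hBδ
      · change ite _ _ _ ∈ _
        split_ifs
        · exact hSmono _ _ ((le_max_left _ _).trans (le_max_right _ _)) hδ (hcyl (e k))
        · exact hBδ
    have hGinter : ⋂ n, G n = B \ (membershipCode A ⁻¹' U) := by
      ext ω
      rw [mem_iInter]
      refine ⟨fun h => ⟨h 0, fun hωU => ?_⟩, fun h n => ?_⟩
      · obtain ⟨p, hωp, hpU⟩ := exists_mem_boolCylinder_subset hU hωU
        obtain ⟨k, rfl⟩ := he p
        have hk : ω ∈ ite _ _ _ := h (k + 1)
        rw [if_pos hpU] at hk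
        exact hk hωp
      · rcases n with _ | k
        · exact h.1
        · change ω ∈ ite _ _ _
          split_ifs with hk
          · exact fun hω => h.2 (hk hω)
          · exact h.1
    obtain ⟨C, hC, hCG, hPC⟩ := hcap δ hδ G hG
    rw [hGinter] at hCG hPC
    refine ⟨C, ⟨⟨δ + 1, ?_, hδ', hC, fun ω hω hωZ => (hCG hω).2 (hZU hωZ)⟩,
      fun ω hω => hBE (hCG hω).1⟩, ?_⟩
    · exact ((le_max_right _ _).trans (le_max_right _ _)).trans le_self_add
    · by_contra! hCr
      have hPU : P (membershipCode A ⁻¹' U) = ν U := by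
        rw [← hmap, Measure.map_apply hcode hU.measurableSet]
      have hle : P B ≤ P C + ν U := by
        rw [hPC, ← hPU]
        exact tsub_le_iff_right.1 le_measure_sdiff
      refine (hle.trans_lt ?_).false
      calc P C + ν U ≤ r + ν U := by gcongr
        _ < r + (P B - r) := ENNReal.add_lt_add_left hrB.ne_top hνU
        _ = P B := add_tsub_cancel_of_le hrB.le
  · exact iSup₂_le fun B hB => measure_mono hB.2
  · by_cases hbdd : ∃ β < κ.ord, D ⊆ S β
    · obtain ⟨β, hβ, hDβ⟩ := hbdd
      exact hsat β hβ D hDβ hfip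
    exfalso
    obtain ⟨𝒰, h𝒰⟩ := Ultrafilter.exists_ultrafilter_of_finite_inter_nonempty D hfip
    -- Some member of `D` avoids `Z β`, yet attains the code of the ultrafilter, which is in `Z β`.
    classical
    obtain ⟨β, hβ, hxβ⟩ := hZcover fun n => decide (A n ∈ 𝒰)
    push Not at hbdd
    obtain ⟨C, hCD, hCβ⟩ := not_subset.1 (hbdd β hβ)
    obtain ⟨γ, hγ₂γ, hγ, hCγ, hCZ⟩ := hD hCD
    have hβγ : β ≤ γ := le_of_not_ge fun h => hCβ (hSmono _ _ h hβ hCγ)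
    let E : ℕ → Set Ω := fun n => if A n ∈ 𝒰 then A n else (A n)ᶜ
    obtain ⟨ω, hω⟩ : (⋂₀ insert C (range E)).Nonempty := by
      refine hsat γ hγ _ (insert_subset hCγ ?_) (hasFIP_of_subset_ultrafilter 𝒰 ?_)
      · rintro _ ⟨n, rfl⟩
        simp only [E]
        split_ifs
        · exact hSmono _ _ zero_le hγ (hA0 n)
        · exact hSmono _ _ hγ₂γ hγ (hAcompl n)
      · rintro _ (rfl | ⟨n, rfl⟩)
        · exact h𝒰 hCD
        · simp only [E]
          split_ifs with h
          · exact h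
          · exact Ultrafilter.compl_mem_iff_notMem.2 h
    refine hCZ ω (hω C (mem_insert _ _)) (hZmono _ _ hβγ hγ ?_)
    convert hxβ using 1
    funext n
    have hn : ω ∈ E n := hω _ (mem_insert_of_mem _ ⟨n, rfl⟩)
    by_cases h : A n ∈ 𝒰
    · simp only [E, if_pos h] at hn
      simpa [h] using membershipCode_eq_true.2 hn
    · simp only [E, if_neg h] at hn
      simpa [h] using membershipCode_eq_false.2 hn
end
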